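/- There is a dense open subset U of the space of homogeneous cubic polynomials in n real variables such that for every p ∈ U and every nonzero x ∈ ℝⁿ, the rank of the Hessian matrix of p at x is at least ⌊n − √(2n)⌋. -/

import Mathlib

/-- The Hessian matrix of `f` at `x`. -/
noncomputable def hessMat {m : ℕ} (f : EuclideanSpace ℝ (Fin m) → ℝ)
    (x : EuclideanSpace ℝ (Fin m)) : Matrix (Fin m) (Fin m) ℝ :=
  Matrix.of fun i j =>
    iteratedFDeriv ℝ 2 f x ![EuclideanSpace.single i 1, EuclideanSpace.single j 1]

/-- A homogeneous cubic polynomial in `n` variables, given by its coefficients indexed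
by degree-3 monomials (multisets of size 3 of variables). -/
noncomputable def cubicEval {n : ℕ} (c : Sym (Fin n) 3 → ℝ)
    (x : EuclideanSpace ℝ (Fin n)) : ℝ :=
  ∑ m : Sym (Fin n) 3, c m * ((m : Multiset (Fin n)).map fun i => x i).prod

theorem sym3_rep {n : ℕ} (m : Sym (Fin n) 3) :
    ∃ t : Fin n × Fin n × Fin n, m = t.1 ::ₛ t.2.1 ::ₛ t.2.2 ::ₛ Sym.nil := by
  obtain ⟨a, m1, rfl⟩ := m.exists_eq_cons_of_succ
  obtain ⟨b, m2, rfl⟩ := m1.exists_eq_cons_of_succ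
  obtain ⟨d, m3, rfl⟩ := m2.exists_eq_cons_of_succ
  exact ⟨(a, b, d), by simp [Sym.eq_nil_of_card_zero m3]⟩

/-- permanent of Kronecker deltas -/
noncomputable def permD {n : ℕ} (a b d i j k : Fin n) : ℝ :=
  (if a = i ∧ b = j ∧ d = k then 1 else 0) + (if a = i ∧ d = j ∧ b = k then 1 else 0) +
  (if b = i ∧ a = j ∧ d = k then 1 else 0) + (if b = i ∧ d = j ∧ a = k then 1 else 0) +
  (if d = i ∧ a = j ∧ b = k then 1 else 0) + (if d = i ∧ b = j ∧ a = k then 1 else 0)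

theorem sym3_eq_iff {n : ℕ} (a b d i j k : Fin n) :
    (a ::ₛ b ::ₛ d ::ₛ Sym.nil : Sym (Fin n) 3) = i ::ₛ j ::ₛ k ::ₛ Sym.nil ↔
     ((a = i ∧ b = j ∧ d = k) ∨ (a = i ∧ d = j ∧ b = k) ∨
      (b = i ∧ a = j ∧ d = k) ∨ (b = i ∧ d = j ∧ a = k) ∨
      (d = i ∧ a = j ∧ b = k) ∨ (d = i ∧ b = j ∧ a = k)) := by
  constructor
  · intro h
    have h' : (a ::ₘ b ::ₘ d ::ₘ 0 : Multiset (Fin n)) = i ::ₘ j ::ₘ k ::ₘ 0 := by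
      have := congrArg Subtype.val h
      exact this
    have h2 : [a,b,d].Perm [i,j,k] := Multiset.coe_eq_coe.1 h'
    have ha : a ∈ [i,j,k] := h2.subset (by simp)
    simp only [List.mem_cons, List.not_mem_nil, or_false] at ha
    rcases ha with rfl | rfl | rfl
    · have h3 := h2.cons_inv
      have hb : b ∈ [j,k] := h3.subset (by simp)
      simp only [List.mem_cons, List.not_mem_nil, or_false] at hb
      rcases hb with rfl | rfl
      · have := h3.cons_inv
        simp at this
        grind
      · have := (h3.trans (List.Perm.swap _ _ _)).cons_inv
        simp at this
        grind
    · have h3 := (h2.trans (List.Perm.swap _ _ _)).cons_inv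
      have hb : b ∈ [i,k] := h3.subset (by simp)
      simp only [List.mem_cons, List.not_mem_nil, or_false] at hb
      rcases hb with rfl | rfl
      · have := h3.cons_inv
        simp at this
        grind
      · have := (h3.trans (List.Perm.swap _ _ _)).cons_inv
        simp at this
        grind
    · have h3 := (h2.trans ((List.Perm.swap _ _ _).cons _ |>.trans (List.Perm.swap _ _ _))).cons_inv
      have hb : b ∈ [i,j] := h3.subset (by simp)
      simp only [List.mem_cons, List.not_mem_nil, or_false] at hb
      rcases hb with rfl | rfl
      · have := h3.cons_inv
        simp at this
        grind
      · have := (h3.trans (List.Perm.swap _ _ _)).cons_inv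
        simp at this
        grind
  · have e1 : ∀ a b d : Fin n, (a ::ₛ b ::ₛ d ::ₛ Sym.nil : Sym (Fin n) 3) = b ::ₛ a ::ₛ d ::ₛ Sym.nil := fun a b d => Sym.cons_swap _ _ _
    have e2 : ∀ a b d : Fin n, (a ::ₛ b ::ₛ d ::ₛ Sym.nil : Sym (Fin n) 3) = a ::ₛ d ::ₛ b ::ₛ Sym.nil := fun a b d => by rw [Sym.cons_swap b d]
    rintro (⟨rfl,rfl,rfl⟩|⟨rfl,rfl,rfl⟩|⟨rfl,rfl,rfl⟩|⟨rfl,rfl,rfl⟩|⟨rfl,rfl,rfl⟩|⟨rfl,rfl,rfl⟩) <;> grind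

theorem permD_ne_zero {n : ℕ} (a b d i j k : Fin n) :
    permD a b d i j k ≠ 0 ↔
    (a ::ₛ b ::ₛ d ::ₛ Sym.nil : Sym (Fin n) 3) = i ::ₛ j ::ₛ k ::ₛ Sym.nil := by
  rw [sym3_eq_iff]
  constructor
  · intro h
    by_contra hc
    push Not at hc
    apply h
    unfold permD
    grind
  · intro h
    apply ne_of_gt
    unfold permD
    rcases h with h | h | h | h | h | h <;> rw [if_pos h] <;> positivity

theorem hess_explicit {n : ℕ} (s : Sym (Fin n) 3 → Fin n × Fin n × Fin n)
   (hs : ∀ m, m = (s m).1 ::ₛ (s m).2.1 ::ₛ (s m).2.2 ::ₛ Sym.nil)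
   (c : Sym (Fin n) 3 → ℝ) (x : EuclideanSpace ℝ (Fin n)) (i j : Fin n) :
   hessMat (cubicEval c) x i j = ∑ k, x k * ∑ m, c m * permD (s m).1 (s m).2.1 (s m).2.2 i j k := by
  have e : cubicEval c = fun x : EuclideanSpace ℝ (Fin n) => ∑ m, c m * (x (s m).1 * x (s m).2.1 * x (s m).2.2) := by
    funext x
    unfold cubicEval
    refine Finset.sum_congr rfl fun m _ => ?_
    congr 1
    conv_lhs => rw [hs m]
    change (Multiset.map _ (_ ::ₘ _ ::ₘ _ ::ₘ 0)).prod = _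
    simp [mul_assoc]
  let pr : Fin n → (EuclideanSpace ℝ (Fin n) →L[ℝ] ℝ) := fun i => EuclideanSpace.proj i
  have hpr : ∀ i x, pr i x = x i := fun i x => rfl
  have d1 : fderiv ℝ (cubicEval c) = fun x : EuclideanSpace ℝ (Fin n) => ∑ m, c m • ((x (s m).1 * x (s m).2.1) • pr (s m).2.2 + (x (s m).2.2) • (x (s m).1 • pr (s m).2.1 + x (s m).2.1 • pr (s m).1)) := by
    rw [e]
    funext x
    apply HasFDerivAt.fderiv
    apply HasFDerivAt.fun_sum
    intro m _
    apply HasFDerivAt.const_mul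
    exact (((pr (s m).1).hasFDerivAt.mul (pr (s m).2.1).hasFDerivAt).mul (pr (s m).2.2).hasFDerivAt)
  have d2 : ∀ x, HasFDerivAt (fderiv ℝ (cubicEval c)) (∑ m, c m • (
      (((x (s m).1) • pr (s m).2.1 + x (s m).2.1 • pr (s m).1).smulRight (pr (s m).2.2)) + 
      ((x (s m).2.2) • ((pr (s m).1).smulRight (pr (s m).2.1) + (pr (s m).2.1).smulRight (pr (s m).1)) + (pr (s m).2.2).smulRight (x (s m).1 • pr (s m).2.1 + x (s m).2.1 • pr (s m).1)))) x := by
    intro x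
    rw [d1]
    apply HasFDerivAt.fun_sum
    intro m _
    have h1 : HasFDerivAt (fun y : EuclideanSpace ℝ (Fin n) => (y (s m).1 * y (s m).2.1) • pr (s m).2.2) _ x :=
      ((pr (s m).1).hasFDerivAt.mul (pr (s m).2.1).hasFDerivAt).smul_const (pr (s m).2.2)
    have h2 : HasFDerivAt (fun y : EuclideanSpace ℝ (Fin n) => y (s m).2.2 • (y (s m).1 • pr (s m).2.1 + y (s m).2.1 • pr (s m).1)) _ x :=
      (pr (s m).2.2).hasFDerivAt.smul (((pr (s m).1).hasFDerivAt.smul_const (pr (s m).2.1)).add ((pr (s m).2.1).hasFDerivAt.smul_const (pr (s m).1)))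
    exact (h1.add h2).const_smul (c m)
  simp only [hessMat, Matrix.of_apply]
  rw [iteratedFDeriv_two_apply, (d2 x).fderiv]
  simp only [Finset.mul_sum]
  rw [Finset.sum_comm]
  simp only [sum_apply]
  refine Finset.sum_congr rfl fun m _ => ?_
  have key : ∀ (a : Fin n) (P : Prop) [Decidable P], ∑ k, x k * (if P ∧ a = k then (1:ℝ) else 0) = if P then x a else 0 := by
    intro a P _
    split_ifs with h <;> simp [h]
  simp only [← and_assoc, permD, mul_left_comm _ (c m)]
  rw [← Finset.mul_sum]
  simp only [mul_add, Finset.sum_add_distrib, key]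
  have hu : ∀ a b : Fin n, (EuclideanSpace.single a (1:ℝ)) b = if b = a then 1 else 0 := by
    intro a b; simp
  change c m * (((x (s m).1 * (EuclideanSpace.single i (1:ℝ)) (s m).2.1 + x (s m).2.1 * (EuclideanSpace.single i (1:ℝ)) (s m).1) * (EuclideanSpace.single j (1:ℝ)) (s m).2.2) +
    (x (s m).2.2 * ((EuclideanSpace.single i (1:ℝ)) (s m).1 * (EuclideanSpace.single j (1:ℝ)) (s m).2.1 + (EuclideanSpace.single i (1:ℝ)) (s m).2.1 * (EuclideanSpace.single j (1:ℝ)) (s m).1) +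
     (EuclideanSpace.single i (1:ℝ)) (s m).2.2 * (x (s m).1 * (EuclideanSpace.single j (1:ℝ)) (s m).2.1 + x (s m).2.1 * (EuclideanSpace.single j (1:ℝ)) (s m).1))) = _
  simp only [hu]
  have hi : ∀ (P Q : Prop) [Decidable P] [Decidable Q] (y : ℝ), (if P ∧ Q then y else 0) = (if P then 1 else 0) * (if Q then 1 else 0) * y := by
    intro P Q _ _ y
    by_cases h : P <;> by_cases h' : Q <;> simp [h, h']
  simp only [hi]
  ring

theorem permD_symm {n : ℕ} (a b d i j k : Fin n) : permD a b d i j k = permD a b d j i k := by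
  have e : ∀ (P Q R : Prop) [Decidable P] [Decidable Q] [Decidable R],
    (if P ∧ Q ∧ R then (1:ℝ) else 0) = if Q ∧ P ∧ R then (1:ℝ) else 0 := by
    intro P Q R _ _ _
    by_cases P <;> by_cases Q <;> simp [*]
  unfold permD
  rw [e (a = j) (b = i), e (a = j) (d = i), e (b = j) (a = i), e (b = j) (d = i), e (d = j) (a = i), e (d = j) (b = i)]
  ring

theorem hess_formula (n : ℕ) : ∃ W : Fin n → Fin n → Fin n → ℝ, (∀ i j k, W i j k ≠ 0) ∧
    (∀ c x i j, hessMat (cubicEval c) x i j =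
      ∑ k, x k * (W i j k * c (i ::ₛ j ::ₛ k ::ₛ Sym.nil))) ∧
    (∀ (c : Sym (Fin n) 3 → ℝ) x i j, hessMat (cubicEval c) x i j = hessMat (cubicEval c) x j i) := by
  choose s hs using sym3_rep (n := n)
  refine ⟨fun i j k => permD (s (i ::ₛ j ::ₛ k ::ₛ Sym.nil)).1 (s (i ::ₛ j ::ₛ k ::ₛ Sym.nil)).2.1 (s (i ::ₛ j ::ₛ k ::ₛ Sym.nil)).2.2 i j k, ?_, ?_, ?_⟩
  · intro i j k
    rw [permD_ne_zero, ← hs]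
  · intro c x i j
    rw [hess_explicit s hs]
    refine Finset.sum_congr rfl fun k _ => ?_
    congr 1
    rw [Finset.sum_eq_single (i ::ₛ j ::ₛ k ::ₛ Sym.nil)]
    · ring
    · intro m _ hm
      have : ¬ (permD (s m).1 (s m).2.1 (s m).2.2 i j k ≠ 0) := by
        rw [permD_ne_zero, ← hs]; exact hm
      rw [not_not.1 this, mul_zero]
    · simp
  · intro c x i j
    rw [hess_explicit s hs, hess_explicit s hs]
    refine Finset.sum_congr rfl fun k _ => ?_
    congr 1
    refine Finset.sum_congr rfl fun m _ => ?_
    congr 1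
    exact permD_symm _ _ _ _ _ _

/-- Parameter space for the chart `(i0, J)`. -/
abbrev ParE (n : ℕ) (i0 : Fin n) (J : Finset (Fin n)) : Type :=
  (Fin n → ℝ) × (({i : Fin n // i ∉ J} × J) → ℝ) × (Sym2 J → ℝ) ×
    ({m : Sym (Fin n) 3 // ¬ i0 ∈ m} → ℝ)

noncomputable def parN {n : ℕ} {i0 : Fin n} {J : Finset (Fin n)} (p : ParE n i0 J)
    (i : Fin n) (j : J) : ℝ :=
  if h : i ∈ J then (if i = j then 1 else 0) else p.2.1 (⟨i, h⟩, j)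

noncomputable def parA {n : ℕ} {i0 : Fin n} {J : Finset (Fin n)} (p : ParE n i0 J)
    (i l : Fin n) : ℝ :=
  ∑ j : J, ∑ j' : J, parN p i j * parN p l j' * p.2.2.1 s(j', j)

noncomputable def stepG {n : ℕ} (W : Fin n → Fin n → Fin n → ℝ) {i0 : Fin n}
    {J : Finset (Fin n)} (f : Sym (Fin n) 3 → Fin n × Fin n) (p : ParE n i0 J)
    (c : Sym (Fin n) 3 → ℝ) : Sym (Fin n) 3 → ℝ := fun m =>
  if h : i0 ∈ m then
    (parA p (f m).1 (f m).2 - ∑ k ∈ Finset.univ.erase i0, p.1 k *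
      (W (f m).1 (f m).2 k * c ((f m).1 ::ₛ (f m).2 ::ₛ k ::ₛ Sym.nil))) / W (f m).1 (f m).2 i0
  else p.2.2.2 ⟨m, h⟩

noncomputable def parPhi {n : ℕ} (W : Fin n → Fin n → Fin n → ℝ) {i0 : Fin n}
    {J : Finset (Fin n)} (f : Sym (Fin n) 3 → Fin n × Fin n) (t : ℕ) (p : ParE n i0 J) :
    Sym (Fin n) 3 → ℝ := (stepG W f p)^[t] 0

theorem contDiff_parA {n : ℕ} {i0 : Fin n} {J : Finset (Fin n)} (i l : Fin n) :
    ContDiff ℝ 1 (fun p : ParE n i0 J => parA p i l) := by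
  have hN : ∀ i j, ContDiff ℝ 1 (fun p : ParE n i0 J => parN p i j) := by
    intro i j
    unfold parN
    split_ifs with h
    · exact contDiff_const
    · exact contDiff_const
    · fun_prop
  unfold parA
  refine ContDiff.sum fun j _ => ContDiff.sum fun j' _ => ?_
  exact ((hN i j).mul (hN l j')).mul (by fun_prop)

theorem contDiff_parPhi {n : ℕ} (W : Fin n → Fin n → Fin n → ℝ) {i0 : Fin n}
    {J : Finset (Fin n)} (f : Sym (Fin n) 3 → Fin n × Fin n) (t : ℕ) :
    ContDiff ℝ 1 (fun p : ParE n i0 J => parPhi W f t p) := by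
  induction t with
  | zero => exact contDiff_const
  | succ t ih =>
    have e : ∀ p : ParE n i0 J, parPhi W f (t+1) p = stepG W f p (parPhi W f t p) := by
      intro p
      unfold parPhi
      rw [Function.iterate_succ_apply']
    simp only [e]
    rw [contDiff_pi]
    intro m
    have ih' := fun m => (contDiff_pi.1 ih) m
    unfold stepG
    by_cases h : i0 ∈ m
    · simp only [h, dif_pos]
      refine ContDiff.div_const (ContDiff.sub (contDiff_parA _ _) ?_) _
      refine ContDiff.sum fun k _ => ContDiff.mul (by fun_prop) (contDiff_const.mul (ih' _))
    · simp only [h, dif_neg, not_false_eq_true]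
      fun_prop

theorem parPhi_eq {n : ℕ} (W : Fin n → Fin n → Fin n → ℝ) (hW : ∀ i j k, W i j k ≠ 0)
    {i0 : Fin n} {J : Finset (Fin n)} (f : Sym (Fin n) 3 → Fin n × Fin n)
    (hf : ∀ m, i0 ∈ m → m = (f m).1 ::ₛ (f m).2 ::ₛ i0 ::ₛ Sym.nil)
    (p : ParE n i0 J) (hp : p.1 i0 = 1) (c : Sym (Fin n) 3 → ℝ)
    (hc : ∀ m : {m : Sym (Fin n) 3 // ¬ i0 ∈ m}, p.2.2.2 m = c m)
    (hA : ∀ i j, parA p i j = ∑ k, p.1 k * (W i j k * c (i ::ₛ j ::ₛ k ::ₛ Sym.nil))) (t : ℕ) :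
    ∀ m : Sym (Fin n) 3, Multiset.count i0 (m : Multiset (Fin n)) < t →
      parPhi W f t p m = c m := by
  induction t with
  | zero => intro m h; omega
  | succ t ih =>
    intro m hm
    unfold parPhi
    rw [Function.iterate_succ_apply']
    change stepG W f p (parPhi W f t p) m = c m
    unfold stepG
    split_ifs with h
    · rw [div_eq_iff (hW _ _ _), hA, ← Finset.add_sum_erase _ _ (Finset.mem_univ i0), hp, ← hf m h]
      have hcnt : Multiset.count i0 (m : Multiset (Fin n)) =
          Multiset.count i0 ((f m).1 ::ₘ (f m).2 ::ₘ 0) + 1 := by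
        have := congrArg (fun q : Sym (Fin n) 3 => Multiset.count i0 (q : Multiset (Fin n))) (hf m h)
        refine this.trans ?_
        change Multiset.count i0 ((f m).1 ::ₘ (f m).2 ::ₘ i0 ::ₘ 0) = _
        simp only [Multiset.count_cons, Multiset.count_zero, if_true]
        ring
      have : ∀ k ∈ Finset.univ.erase i0, p.1 k * (W (f m).1 (f m).2 k *
          parPhi W f t p ((f m).1 ::ₛ (f m).2 ::ₛ k ::ₛ Sym.nil)) =
          p.1 k * (W (f m).1 (f m).2 k * c ((f m).1 ::ₛ (f m).2 ::ₛ k ::ₛ Sym.nil)) := by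
        intro k hk
        rw [ih]
        have : Multiset.count i0 (((f m).1 ::ₛ (f m).2 ::ₛ k ::ₛ Sym.nil : Sym (Fin n) 3) : Multiset (Fin n)) =
          Multiset.count i0 ((f m).1 ::ₘ (f m).2 ::ₘ 0) := by
          change Multiset.count i0 ((f m).1 ::ₘ (f m).2 ::ₘ k ::ₘ 0) = _
          have : i0 ≠ k := fun h => (Finset.ne_of_mem_erase hk) h.symm
          simp only [Multiset.count_cons, Multiset.count_zero, if_neg this]
        omega
      rw [Finset.sum_congr rfl this]
      ring
    · exact hc ⟨m, h⟩

theorem exists_rows {n r : ℕ} (A : Matrix (Fin n) (Fin n) ℝ) (hr : A.rank ≤ r) (hrn : r ≤ n) :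
    ∃ J : Finset (Fin n), J.card = r ∧ ∀ i, ∃ g : J → ℝ, ∑ j, g j • A j = A i := by
  classical
  obtain ⟨κ, a, ha, hsp, hli⟩ := exists_linearIndependent' ℝ (fun i => A i)
  have : Finite κ := Finite.of_injective a ha
  have : Fintype κ := Fintype.ofFinite κ
  have hcard : Fintype.card κ = A.rank := by
    rw [Matrix.rank_eq_finrank_span_row, ← finrank_span_eq_card hli, hsp]
    rfl
  obtain ⟨J, hJ, hJc⟩ := Finset.exists_superset_card_eq (s := Finset.univ.image a) (n := r)
    (by rw [Finset.card_image_of_injective _ ha]; simpa [hcard] using hr) (by simpa using hrn)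
  refine ⟨J, hJc, fun i => ?_⟩
  rw [← Submodule.mem_span_image_finset_iff_exists_fun (R := ℝ) (v := fun i => A i)]
  have h1 : A i ∈ Submodule.span ℝ (Set.range (fun i => A i)) := Submodule.subset_span ⟨i, rfl⟩
  rw [← hsp] at h1
  refine Submodule.span_mono ?_ h1
  rintro _ ⟨k, rfl⟩
  exact ⟨a k, hJ (by simp), rfl⟩

theorem finrank_ParE {n r : ℕ} (i0 : Fin n) (J : Finset (Fin n)) (hJ : J.card = r) (hrn : r ≤ n)
    (h : 2 * n < (n - r) * (n - r)) :
    Module.finrank ℝ (ParE n i0 J) + 1 ≤ Fintype.card (Sym (Fin n) 3) := by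
  have h1 : Fintype.card {m : Sym (Fin n) 3 // ¬ i0 ∈ m} + (n + 1).choose 2 ≤ Fintype.card (Sym (Fin n) 3) := by
    have e1 := Fintype.card_subtype_compl (fun m : Sym (Fin n) 3 => i0 ∈ m)
    have e2 := Fintype.card_subtype_le (fun m : Sym (Fin n) 3 => i0 ∈ m)
    have e3 : Fintype.card (Sym (Fin n) 2) ≤ Fintype.card {m : Sym (Fin n) 3 // i0 ∈ m} := by
      refine Fintype.card_le_of_injective (fun q => ⟨i0 ::ₛ q, Sym.mem_cons_self _ _⟩) ?_
      intro q q' hq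
      simpa using hq
    rw [Sym.card_sym_eq_choose, Fintype.card_fin] at e3
    have : n + 2 - 1 = n + 1 := by omega
    rw [this] at e3
    omega
  have h2 : Module.finrank ℝ (ParE n i0 J) = n + ((n - r) * r + ((r+1).choose 2 +
      Fintype.card {m : Sym (Fin n) 3 // ¬ i0 ∈ m})) := by
    have e4 : Fintype.card {i : Fin n // i ∉ J} = n - r := by
      rw [Fintype.card_subtype_compl]; simp [hJ]
    unfold ParE
    rw [Module.finrank_prod, Module.finrank_prod, Module.finrank_prod]
    simp only [Module.finrank_fintype_fun_eq_card, Fintype.card_prod, e4, Sym2.card, Fintype.card_coe, hJ, Fintype.card_fin]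
  obtain ⟨k, rfl⟩ := Nat.exists_eq_add_of_le hrn
  have c1 : ∀ a : ℕ, 2 * (a + 1).choose 2 = (a + 1) * a := by
    intro a
    rw [Nat.choose_two_right, Nat.add_sub_cancel]
    exact Nat.mul_div_cancel' (by rw [mul_comm]; exact (Nat.even_mul_succ_self a).two_dvd)
  have a1 := c1 (r + k)
  have a2 := c1 r
  simp only [Nat.add_sub_cancel_left] at *
  rw [h2]
  nlinarith

theorem numerics (n : ℕ) (hR : 0 < (⌊(n : ℝ) - Real.sqrt (2 * n)⌋).toNat) :
    ∃ r, (⌊(n : ℝ) - Real.sqrt (2 * n)⌋).toNat = r + 1 ∧ r ≤ n ∧ 2 * n < (n - r) * (n - r) := by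
  obtain ⟨r, hr⟩ := Nat.exists_eq_succ_of_ne_zero hR.ne'
  refine ⟨r, hr, ?_⟩
  have h1 : ((r + 1 : ℕ) : ℤ) ≤ ⌊(n : ℝ) - Real.sqrt (2 * n)⌋ := by omega
  rw [Int.le_floor] at h1
  push_cast at h1
  have h0 := Real.sqrt_nonneg (2 * n : ℝ)
  have hsq := Real.sq_sqrt (show (0:ℝ) ≤ 2 * n by positivity)
  have hrn : r ≤ n := by
    have : (r : ℝ) ≤ n := by linarith
    exact_mod_cast this
  refine ⟨hrn, ?_⟩
  have : (2 * n : ℝ) < ((n - r : ℕ) : ℝ) * ((n - r : ℕ) : ℝ) := by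
    rw [Nat.cast_sub hrn]
    nlinarith
  exact_mod_cast this

theorem mem_range_parPhi {n r : ℕ} (W : Fin n → Fin n → Fin n → ℝ) (hW : ∀ i j k, W i j k ≠ 0)
    (f : Fin n → Sym (Fin n) 3 → Fin n × Fin n)
    (hf : ∀ i0 m, i0 ∈ m → m = (f i0 m).1 ::ₛ (f i0 m).2 ::ₛ i0 ::ₛ Sym.nil) (hrn : r ≤ n)
    (c : Sym (Fin n) 3 → ℝ) (x : Fin n → ℝ) (i0 : Fin n) (hx : x i0 = 1)
    (A : Matrix (Fin n) (Fin n) ℝ)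
    (hA : ∀ i j, A i j = ∑ k, x k * (W i j k * c (i ::ₛ j ::ₛ k ::ₛ Sym.nil)))
    (hs : ∀ i j, A i j = A j i) (hr : A.rank ≤ r) :
    ∃ J : Finset (Fin n), J.card = r ∧
      c ∈ Set.range (fun p : ParE n i0 J => parPhi W (f i0) 4 p) := by
  obtain ⟨J, hJ, hg⟩ := exists_rows A hr hrn
  choose g hg using hg
  refine ⟨J, hJ, ⟨⟨x, fun q => g q.1 q.2, Sym2.lift ⟨fun j j' => A j j', fun j j' => hs _ _⟩,
    fun m => c m⟩, ?_⟩⟩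
  funext m
  refine parPhi_eq W hW (f i0) (hf i0) _ hx c (fun m => rfl) ?_ 4 m ?_
  · intro i l
    simp only [← hA]
    unfold parA
    have key : ∀ i l, ∑ j : J, parN (i0 := i0) (J := J) ⟨x, fun q => g q.1 q.2, Sym2.lift ⟨fun j j' => A j j', fun j j' => hs _ _⟩,
      fun m => c m⟩ i j * A j l = A i l := by
      intro i l
      by_cases h : i ∈ J
      · simp only [parN, h, dif_pos]
        rw [Finset.sum_eq_single ⟨i, h⟩]
        · simp
        · intro b _ hb
          rw [if_neg, zero_mul]
          intro h'
          apply hb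
          ext1
          exact h'.symm
        · simp
      · simp only [parN, h, dif_neg, not_false_eq_true]
        have := congrFun (hg i) l
        simpa using this
    conv_rhs => rw [← key i l]
    refine Finset.sum_congr rfl fun j _ => ?_
    rw [hs j l, ← key l j, Finset.mul_sum]
    refine Finset.sum_congr rfl fun j' _ => ?_
    rw [mul_assoc]
    rfl
  · have := Multiset.count_le_card i0 (m : Multiset (Fin n))
    have h3 : Multiset.card (m : Multiset (Fin n)) = 3 := m.2
    omega

theorem dense_good (n r : ℕ) (hrn : r ≤ n) (h : 2 * n < (n - r) * (n - r)) :
    Dense {c : Sym (Fin n) 3 → ℝ | ∀ x : EuclideanSpace ℝ (Fin n), x ≠ 0 →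
      r + 1 ≤ (hessMat (cubicEval c) x).rank} := by
  obtain ⟨W, hW, hH, hsym⟩ := hess_formula n
  have hf : ∀ (i0 : Fin n) (m : Sym (Fin n) 3), ∃ t : Fin n × Fin n, i0 ∈ m →
      m = t.1 ::ₛ t.2 ::ₛ i0 ::ₛ Sym.nil := by
    intro i0 m
    by_cases hm : i0 ∈ m
    · obtain ⟨m1, rfl⟩ := Sym.exists_cons_of_mem hm
      obtain ⟨b, m2, rfl⟩ := m1.exists_eq_cons_of_succ
      obtain ⟨d, m3, rfl⟩ := m2.exists_eq_cons_of_succ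
      refine ⟨(b, d), fun _ => ?_⟩
      rw [Sym.eq_nil_of_card_zero m3, Sym.cons_swap i0 b, Sym.cons_swap i0 d]
    · exact ⟨(i0, i0), fun h => absurd h hm⟩
  choose f hf using hf
  let B : Set (Sym (Fin n) 3 → ℝ) := ⋃ i0 : Fin n, ⋃ J : {J : Finset (Fin n) // J.card = r},
    Set.range (fun p : ParE n i0 J.1 => parPhi W (f i0) 4 p)
  have hB : Dense Bᶜ := by
    apply dense_compl_of_dimH_lt_finrank
    have : dimH B ≤ ((Fintype.card (Sym (Fin n) 3) - 1 : ℕ) : ENNReal) := by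
      simp only [B, dimH_iUnion]
      refine iSup_le fun i0 => iSup_le fun J => ?_
      refine (contDiff_parPhi W (f i0) 4).dimH_range_le.trans ?_
      have := finrank_ParE i0 J.1 J.2 hrn h
      exact_mod_cast (show _ ≤ _ by omega)
    refine this.trans_lt ?_
    rw [Module.finrank_fintype_fun_eq_card]
    have : 0 < Fintype.card (Sym (Fin n) 3) := by
      have hn : 0 < n := by
        rcases Nat.eq_zero_or_pos n with rfl | h'
        · simp at h
        · exact h'
      exact Fintype.card_pos_iff.2 ⟨⟨Multiset.replicate 3 ⟨0, hn⟩, by simp⟩⟩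
    exact_mod_cast (show _ < _ by omega)
  refine hB.mono ?_
  intro c hc x hx
  by_contra hlt
  apply hc
  obtain ⟨i0, hi0⟩ : ∃ i0, x i0 ≠ 0 := by
    by_contra hcon
    push Not at hcon
    exact hx (by ext i; simpa using hcon i)
  have hsm : hessMat (cubicEval c) ((x i0)⁻¹ • x) = (x i0)⁻¹ • hessMat (cubicEval c) x := by
    ext i j
    simp only [Matrix.smul_apply, hH, Finset.smul_sum]
    refine Finset.sum_congr rfl fun k _ => ?_
    simp [mul_assoc]
  have hrk : (hessMat (cubicEval c) ((x i0)⁻¹ • x)).rank ≤ r := by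
    rw [hsm]
    have : ((x i0)⁻¹ • hessMat (cubicEval c) x) =
      (Matrix.diagonal fun _ => (x i0)⁻¹) * hessMat (cubicEval c) x := by
      ext i j; simp
    rw [this]
    exact (Matrix.rank_mul_le_right _ _).trans (by omega)
  obtain ⟨J, hJ, hc'⟩ := mem_range_parPhi W hW f hf hrn c ((x i0)⁻¹ • x).ofLp i0
    (by simp [hi0]) _ (fun i j => hH c _ i j) (hsym c _) hrk
  simp only [B, Set.mem_iUnion]
  exact ⟨i0, ⟨J, hJ⟩, hc'⟩

theorem isOpen_good (n R : ℕ) :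
    IsOpen {c : Sym (Fin n) 3 → ℝ | ∀ x : EuclideanSpace ℝ (Fin n), x ≠ 0 →
      R ≤ (hessMat (cubicEval c) x).rank} := by
  obtain ⟨W, hW, hH, hsym⟩ := hess_formula n
  let S := Metric.sphere (0 : EuclideanSpace ℝ (Fin n)) 1
  have hcont : Continuous fun q : (Sym (Fin n) 3 → ℝ) × S => hessMat (cubicEval q.1) q.2.1 := by
    refine continuous_matrix fun i j => ?_
    simp only [hH]
    fun_prop
  have hop : IsOpen {q : (Sym (Fin n) 3 → ℝ) × S | R ≤ (hessMat (cubicEval q.1) q.2.1).rank} := by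
    have h1 := isOpen_setOfPred_nat_le_rank (𝕜 := ℝ) (E := Fin n → ℝ) (F := Fin n → ℝ) R
    let L : Matrix (Fin n) (Fin n) ℝ →ₗ[ℝ] ((Fin n → ℝ) →L[ℝ] (Fin n → ℝ)) :=
      (LinearMap.toContinuousLinearMap.toLinearMap).comp (Matrix.toLin' : _ ≃ₗ[ℝ] _).toLinearMap
    have hL : Continuous L := L.continuous_of_finiteDimensional
    have h2 := h1.preimage (hL.comp hcont)
    convert h2 using 1
    ext q
    simp only [Set.mem_ofPred_eq, Set.mem_preimage]
    have : ((L (hessMat (cubicEval q.1) q.2.1) : (Fin n → ℝ) →L[ℝ] (Fin n → ℝ)) : (Fin n → ℝ) →ₗ[ℝ] (Fin n → ℝ)).rank = (hessMat (cubicEval q.1) q.2.1).rank := by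
      have hfr : ∀ g : (Fin n → ℝ) →ₗ[ℝ] (Fin n → ℝ),
          g.rank = (Module.finrank ℝ (LinearMap.range g) : Cardinal) :=
        fun g => (Module.finrank_eq_rank _ _).symm
      exact hfr _
    simp only [Function.comp_apply]
    rw [this]
    exact Nat.cast_le.symm
  have hcl := isClosedMap_fst_of_compactSpace (X := Sym (Fin n) 3 → ℝ) (Y := S) _ hop.isClosed_compl
  convert hcl.isOpen_compl using 1
  ext c
  simp only [Set.mem_ofPred_eq, Set.mem_compl_iff, Set.mem_image, not_exists, not_and, Prod.forall]
  constructor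
  · rintro h c' x hx rfl
    refine hx (h x ?_)
    intro h0
    have := x.2
    simp [S, h0] at this
  · intro h x hx
    have hnx : ‖x‖ ≠ 0 := norm_ne_zero_iff.2 hx
    by_contra hlt
    refine h c ⟨‖x‖⁻¹ • x, ?_⟩ ?_ rfl
    · simp [S, norm_smul, hnx]
    · intro h'
      apply hlt
      refine le_trans h' ?_
      have : hessMat (cubicEval c) (‖x‖⁻¹ • x) =
        (Matrix.diagonal fun _ => ‖x‖⁻¹) * hessMat (cubicEval c) x := by
        ext i j
        simp only [Matrix.diagonal_mul, hH, Finset.mul_sum]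
        refine Finset.sum_congr rfl fun k _ => ?_
        simp [mul_assoc]
      change (hessMat (cubicEval c) (‖x‖⁻¹ • x)).rank ≤ _
      rw [this]
      exact Matrix.rank_mul_le_right _ _

theorem stmt17 (n : ℕ) :
    ∃ U : Set (Sym (Fin n) 3 → ℝ), IsOpen U ∧ Dense U ∧
      ∀ c ∈ U, ∀ x : EuclideanSpace ℝ (Fin n), x ≠ 0 →
        (⌊(n : ℝ) - Real.sqrt (2 * n)⌋).toNat ≤ (hessMat (cubicEval c) x).rank := by
  rcases Nat.eq_zero_or_pos (⌊(n : ℝ) - Real.sqrt (2 * n)⌋).toNat with h0 | hpos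
  · exact ⟨Set.univ, isOpen_univ, dense_univ, fun c _ x _ => by rw [h0]; exact Nat.zero_le _⟩
  · obtain ⟨r, hr, hrn, h⟩ := numerics n hpos
    refine ⟨_, isOpen_good n (r + 1), dense_good n r hrn h, ?_⟩
    intro c hc x hx
    rw [hr]
    exact hc x hx
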